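/- Let (λ,μ,ν) be 2D partitions and C_{λμν} the union of the three legs L₁ = {(i,j,k) : (j,k) ∈ λ}, L₂ = {(i,j,k) : (k,i) ∈ μ}, L₃ = {(i,j,k) : (i,j) ∈ ν}. Then for every natural number n there are only finitely many 3D partitions η asymptotic to (λ,μ,ν) with #(η ∖ C_{λμν}) = n. Consequently, for each integer m there are only finitely many 3D partitions asymptotic to (λ,μ,ν) with renormalized volume m, so the topological vertex V_{λμν}(p) = Σ_η p^{|η|} is a well-defined element of ℤ((p)). -/

import Mathlib

/-! Basic combinatorial setup: 2D partitions, 3D partitions, legs,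
renormalized volume and the topological vertex, following
Okounkov–Reshetikhin–Vafa and Bryan–Kool. -/

/-- A 2D partition: a weakly decreasing sequence of naturals with finitely many
nonzero terms (indexed from 0, so `parts 0` is the largest part `λ₁`). -/
structure Partition2D where
  parts : ℕ → ℕ
  antitone : ∀ ⦃i j : ℕ⦄, i ≤ j → parts j ≤ parts i
  finite_support : ∃ N : ℕ, ∀ i : ℕ, N ≤ i → parts i = 0

namespace Partition2D

/-- The Young diagram of a 2D partition, as a subset of `ℤ≥0 × ℤ≥0`. -/
def cells (l : Partition2D) : Set (ℕ × ℕ) := {c | c.2 < l.parts c.1}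

/-- The size `|λ| = Σᵢ λᵢ`. -/
noncomputable def size (l : Partition2D) : ℕ := ∑ᶠ i, l.parts i

/-- The norm `‖λ‖² = Σᵢ λᵢ²`. -/
noncomputable def normSq (l : Partition2D) : ℕ := ∑ᶠ i, (l.parts i) ^ 2

theorem finite_gt (l : Partition2D) (j : ℕ) : {i : ℕ | j < l.parts i}.Finite := by
  obtain ⟨N, hN⟩ := l.finite_support
  refine Set.Finite.subset (Set.finite_Iio N) fun i hi => ?_
  simp only [Set.mem_setOf_eq] at hi
  simp only [Set.mem_Iio]
  by_contra hc
  push_neg at hc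
  rw [hN i hc] at hi
  omega

/-- The conjugate partition: `λᵗⱼ = #{i : λᵢ ≥ j}`; with our 0-indexing,
`conj.parts j = #{i : λᵢ > j}`. -/
noncomputable def conj (l : Partition2D) : Partition2D where
  parts j := {i : ℕ | j < l.parts i}.ncard
  antitone := fun j j' h =>
    Set.ncard_le_ncard (fun i hi => lt_of_le_of_lt h hi) (l.finite_gt j)
  finite_support := ⟨l.parts 0, fun j hj => by
    have h : {i : ℕ | j < l.parts i} = ∅ := by
      ext i
      simp only [Set.mem_setOf_eq, Set.mem_empty_iff_false, iff_false, not_lt]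
      exact le_trans (l.antitone (Nat.zero_le i)) hj
    show {i : ℕ | j < l.parts i}.ncard = 0
    rw [h, Set.ncard_empty]⟩

/-- The empty partition `∅`. -/
def emptyPart : Partition2D :=
  ⟨fun _ => 0, fun _ _ _ => le_rfl, ⟨0, fun _ _ => rfl⟩⟩

/-- The one-box partition `□ = (1,0,0,…)`. -/
def boxPart : Partition2D where
  parts i := if i = 0 then 1 else 0
  antitone := by
    intro i j hij
    split <;> split <;> omega
  finite_support := ⟨1, fun i hi => if_neg (by omega)⟩

end Partition2D

open Partition2D

/-- A 3D partition: a downward-closed subset of `ℤ≥0³`. -/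
def IsPartition3D (η : Set (ℕ × ℕ × ℕ)) : Prop :=
  ∀ i j k : ℕ,
    ((i + 1, j, k) ∈ η → (i, j, k) ∈ η) ∧
    ((i, j + 1, k) ∈ η → (i, j, k) ∈ η) ∧
    ((i, j, k + 1) ∈ η → (i, j, k) ∈ η)

/-- The first leg `L₁ = {(i,j,k) : (j,k) ∈ λ}`. -/
def leg1 (l : Partition2D) : Set (ℕ × ℕ × ℕ) := {b | (b.2.1, b.2.2) ∈ l.cells}

/-- The second leg `L₂ = {(i,j,k) : (k,i) ∈ μ}`. -/
def leg2 (m : Partition2D) : Set (ℕ × ℕ × ℕ) := {b | (b.2.2, b.1) ∈ m.cells}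

/-- The third leg `L₃ = {(i,j,k) : (i,j) ∈ ν}`. -/
def leg3 (n : Partition2D) : Set (ℕ × ℕ × ℕ) := {b | (b.1, b.2.1) ∈ n.cells}

/-- The union of the three legs, `C_{λμν}`. -/
def legs (l m n : Partition2D) : Set (ℕ × ℕ × ℕ) := leg1 l ∪ leg2 m ∪ leg3 n

/-- `η` is asymptotic to the triple of 2D partitions `(λ,μ,ν)`. -/
def IsAsymptotic (l m n : Partition2D) (η : Set (ℕ × ℕ × ℕ)) : Prop :=
  (∀ j k : ℕ, (∃ N, ∀ i, N ≤ i → (i, j, k) ∈ η) ↔ (j, k) ∈ l.cells) ∧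
  (∀ k i : ℕ, (∃ N, ∀ j, N ≤ j → (i, j, k) ∈ η) ↔ (k, i) ∈ m.cells) ∧
  (∀ i j : ℕ, (∃ N, ∀ k, N ≤ k → (i, j, k) ∈ η) ↔ (i, j) ∈ n.cells)

open Classical in
/-- The weight `ξ(b) = 1 − #{legs containing b}` of a box. -/
noncomputable def weight (l m n : Partition2D) (b : ℕ × ℕ × ℕ) : ℤ :=
  1 - ((if b ∈ leg1 l then (1 : ℤ) else 0) + (if b ∈ leg2 m then (1 : ℤ) else 0) +
    (if b ∈ leg3 n then (1 : ℤ) else 0))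

/-- The renormalized volume `|η| = Σ_{b ∈ η} ξ(b)` (a finite sum for `η`
asymptotic to `(λ,μ,ν)`). -/
noncomputable def renormVolume (l m n : Partition2D) (η : Set (ℕ × ℕ × ℕ)) : ℤ :=
  ∑ᶠ b ∈ η, weight l m n b

/-- The coefficient of `p^v` in the topological vertex: the number of 3D partitions
asymptotic to `(λ,μ,ν)` with renormalized volume `v`. -/
noncomputable def vertexCoeff (l m n : Partition2D) (v : ℤ) : ℤ :=
  Nat.card {η : Set (ℕ × ℕ × ℕ) //
    IsPartition3D η ∧ IsAsymptotic l m n η ∧ renormVolume l m n η = v}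


section Helpers

theorem aux_bound (l : Partition2D) :
    ∃ B : ℕ, ∀ C, B ≤ C → ∀ j k, (j, k) ∈ l.cells → j < C ∧ k < C := by
  obtain ⟨N, hN⟩ := l.finite_support
  refine ⟨max N (l.parts 0), fun C hC j k h => ?_⟩
  have h' : k < l.parts j := h
  have h0 := l.antitone (Nat.zero_le j)
  constructor
  · by_contra hc
    have := hN j (by omega)
    omega
  · omega

theorem aux_bound3 (l m n : Partition2D) :
    ∃ B : ℕ, (∀ j k, (j, k) ∈ l.cells → j < B ∧ k < B) ∧
      (∀ j k, (j, k) ∈ m.cells → j < B ∧ k < B) ∧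
      (∀ j k, (j, k) ∈ n.cells → j < B ∧ k < B) := by
  obtain ⟨a, ha⟩ := aux_bound l
  obtain ⟨b, hb⟩ := aux_bound m
  obtain ⟨c, hc⟩ := aux_bound n
  exact ⟨a + b + c, ha _ (by omega), hb _ (by omega), hc _ (by omega)⟩

theorem aux_down {η : Set (ℕ × ℕ × ℕ)} (h : IsPartition3D η) {i j k i' j' k' : ℕ}
    (hi : i' ≤ i) (hj : j' ≤ j) (hk : k' ≤ k) (hm : (i, j, k) ∈ η) : (i', j', k') ∈ η := by
  have h1 : (i', j, k) ∈ η := by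
    induction i, hi using Nat.le_induction with
    | base => exact hm
    | succ a ha ih => exact ih ((h a j k).1 hm)
  have h2 : (i', j', k) ∈ η := by
    clear hm
    induction j, hj using Nat.le_induction with
    | base => exact h1
    | succ a ha ih => exact ih ((h i' a k).2.1 h1)
  clear hm h1
  induction k, hk using Nat.le_induction with
  | base => exact h2
  | succ a ha ih => exact ih ((h i' j' a).2.2 h2)

theorem aux_legs_subset {l m n : Partition2D} {η : Set (ℕ × ℕ × ℕ)}
    (h : IsPartition3D η) (ha : IsAsymptotic l m n η) : legs l m n ⊆ η := by
  rintro ⟨i, j, k⟩ ((hb | hb) | hb)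
  · obtain ⟨N, hN⟩ := (ha.1 j k).2 hb
    exact aux_down h (le_max_left i N) le_rfl le_rfl (hN _ (le_max_right _ _))
  · obtain ⟨N, hN⟩ := (ha.2.1 k i).2 hb
    exact aux_down h le_rfl (le_max_left j N) le_rfl (hN _ (le_max_right _ _))
  · obtain ⟨N, hN⟩ := (ha.2.2 i j).2 hb
    exact aux_down h le_rfl le_rfl (le_max_left k N) (hN _ (le_max_right _ _))

/-- A generic bound in one direction: `P x y z` is downward closed, and each line in the `x`
direction over a point outside of the diagram is bounded. -/
theorem aux_dir (l : Partition2D) (P : ℕ → ℕ → ℕ → Prop)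
    (hd : ∀ x y z x' y' z', x' ≤ x → y' ≤ y → z' ≤ z → P x y z → P x' y' z')
    (ha : ∀ y z, (∃ N, ∀ x, N ≤ x → P x y z) ↔ (y, z) ∈ l.cells) :
    ∃ M, ∀ x y z, P x y z → (y, z) ∉ l.cells → x < M := by
  obtain ⟨B, hB⟩ := aux_bound l
  have hB := hB B le_rfl
  have h1 : ∀ y z, ∃ M, (y, z) ∉ l.cells → ¬ P M y z := by
    intro y z
    by_cases hc : (y, z) ∈ l.cells
    · exact ⟨0, fun h => absurd hc h⟩
    · by_contra hcon
      push Not at hcon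
      exact hc ((ha y z).1 ⟨0, fun x _ => (hcon x).2⟩)
  choose f hf using h1
  refine ⟨∑ p ∈ Finset.range (B + 1) ×ˢ Finset.range (B + 1), f p.1 p.2, fun x y z hP hc => ?_⟩
  by_contra hx
  have hc' : (min y B, min z B) ∉ l.cells := by
    intro hmem
    have := hB _ _ hmem
    have e1 : min y B = y := by omega
    have e2 : min z B = z := by omega
    rw [e1, e2] at hmem
    exact hc hmem
  have hle : f (min y B) (min z B) ≤
      ∑ p ∈ Finset.range (B + 1) ×ˢ Finset.range (B + 1), f p.1 p.2 :=
    Finset.single_le_sum (f := fun p : ℕ × ℕ => f p.1 p.2) (fun _ _ => Nat.zero_le _)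
      (a := (min y B, min z B)) (by
        simp only [Finset.mem_product, Finset.mem_range]; omega)
  exact hf _ _ hc' (hd x y z _ _ _ (by omega) (min_le_left _ _) (min_le_left _ _) hP)

theorem aux_box_finite (M : ℕ) : {b : ℕ × ℕ × ℕ | b.1 < M ∧ b.2.1 < M ∧ b.2.2 < M}.Finite := by
  refine ((Set.finite_Iio M).prod ((Set.finite_Iio M).prod (Set.finite_Iio M))).subset ?_
  rintro ⟨i, j, k⟩ h
  exact h

theorem aux_notmem_legs {l m n : Partition2D} {i j k : ℕ} :
    (i, j, k) ∉ legs l m n ↔ (j, k) ∉ l.cells ∧ (k, i) ∉ m.cells ∧ (i, j) ∉ n.cells := by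
  simp only [legs, leg1, leg2, leg3, Set.mem_union, Set.mem_setOf_eq]
  tauto

theorem aux_diff_finite {l m n : Partition2D} {η : Set (ℕ × ℕ × ℕ)}
    (h : IsPartition3D η) (ha : IsAsymptotic l m n η) : (η \ legs l m n).Finite := by
  obtain ⟨a, h1⟩ := aux_dir l (fun x y z => (x, y, z) ∈ η)
    (fun _ _ _ _ _ _ h1 h2 h3 hm => aux_down h h1 h2 h3 hm) ha.1
  obtain ⟨b, h2⟩ := aux_dir m (fun x y z => (z, x, y) ∈ η)
    (fun _ _ _ _ _ _ h1 h2 h3 hm => aux_down h h3 h1 h2 hm) ha.2.1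
  obtain ⟨c, h3⟩ := aux_dir n (fun x y z => (y, z, x) ∈ η)
    (fun _ _ _ _ _ _ h1 h2 h3 hm => aux_down h h2 h3 h1 hm) ha.2.2
  refine (aux_box_finite (a + b + c)).subset ?_
  rintro ⟨i, j, k⟩ ⟨hm, hl⟩
  rw [aux_notmem_legs] at hl
  have := h1 i j k hm hl.1
  have := h2 j k i hm hl.2.1
  have := h3 k i j hm hl.2.2
  simp only [Set.mem_setOf_eq]
  omega

theorem aux_line {D : Set (ℕ × ℕ × ℕ)} (hD : D.Finite) (B i : ℕ) (g : ℕ → ℕ × ℕ × ℕ)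
    (hg : Function.Injective g) (h : ∀ x, B ≤ x → x ≤ i → g x ∈ D) : i < D.ncard + B := by
  have h1 : (g '' Set.Icc B i).ncard ≤ D.ncard :=
    Set.ncard_le_ncard (by rintro _ ⟨x, hx, rfl⟩; exact h x hx.1 hx.2) hD
  rw [Set.ncard_image_of_injective _ hg, ← Finset.coe_Icc, Set.ncard_coe_finset,
    Nat.card_Icc] at h1
  omega

theorem aux_part1 (l m n : Partition2D) (N : ℕ) :
    {η : Set (ℕ × ℕ × ℕ) | IsPartition3D η ∧ IsAsymptotic l m n η ∧
        (η \ legs l m n).Finite ∧ (η \ legs l m n).ncard = N}.Finite := by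
  obtain ⟨B, hl, hm, hn⟩ := aux_bound3 l m n
  refine ((aux_box_finite (N + B)).powerset.image (fun D => D ∪ legs l m n)).subset ?_
  rintro η ⟨hp, ha, hf, hc⟩
  refine ⟨η \ legs l m n, ?_, Set.diff_union_of_subset (aux_legs_subset hp ha)⟩
  rintro ⟨i, j, k⟩ ⟨hmem, hleg⟩
  rw [aux_notmem_legs] at hleg
  obtain ⟨h1, h2, h3⟩ := hleg
  rw [← hc]
  refine ⟨aux_line hf B i (fun x => (x, j, k)) (fun a b h => by simpa using h) ?_,
    aux_line hf B j (fun x => (i, x, k)) (fun a b h => by simpa using h) ?_,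
    aux_line hf B k (fun x => (i, j, x)) (fun a b h => by simpa using h) ?_⟩
  · intro x hx hxi
    refine ⟨aux_down hp hxi le_rfl le_rfl hmem, aux_notmem_legs.2 ⟨h1, fun h => ?_, fun h => ?_⟩⟩
    · have := hm _ _ h; omega
    · have := hn _ _ h; omega
  · intro x hx hxi
    refine ⟨aux_down hp le_rfl hxi le_rfl hmem, aux_notmem_legs.2 ⟨fun h => ?_, h2, fun h => ?_⟩⟩
    · have := hl _ _ h; omega
    · have := hn _ _ h; omega
  · intro x hx hxi
    refine ⟨aux_down hp le_rfl le_rfl hxi hmem, aux_notmem_legs.2 ⟨fun h => ?_, fun h => ?_, h3⟩⟩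
    · have := hl _ _ h; omega
    · have := hm _ _ h; omega

theorem aux_legs_support (l m n : Partition2D) :
    (legs l m n ∩ Function.support (weight l m n)).Finite := by
  obtain ⟨B, hl, hm, hn⟩ := aux_bound3 l m n
  refine (aux_box_finite B).subset ?_
  rintro ⟨i, j, k⟩ ⟨hb, hw⟩
  have hl := hl j k
  have hm := hm k i
  have hn := hn i j
  simp only [legs, leg1, leg2, leg3, Set.mem_union, Set.mem_setOf_eq, weight,
    Function.mem_support] at hb hw ⊢
  by_cases c1 : (j, k) ∈ l.cells <;> by_cases c2 : (k, i) ∈ m.cells <;>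
    by_cases c3 : (i, j) ∈ n.cells <;> simp [c1, c2, c3] at hb hw hl hm hn ⊢ <;> omega

theorem aux_volume {l m n : Partition2D} {η : Set (ℕ × ℕ × ℕ)}
    (h : IsPartition3D η) (ha : IsAsymptotic l m n η) :
    renormVolume l m n η =
      ((η \ legs l m n).ncard : ℤ) + ∑ᶠ b ∈ legs l m n, weight l m n b := by
  have hf := aux_diff_finite h ha
  have e : ∑ᶠ b ∈ η \ legs l m n, weight l m n b = ((η \ legs l m n).ncard : ℤ) := by
    rw [finsum_mem_eq_finite_toFinset_sum _ hf, Set.ncard_eq_toFinset_card _ hf,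
      Finset.card_eq_sum_ones, Nat.cast_sum]
    refine Finset.sum_congr rfl fun b hb => ?_
    rw [Set.Finite.mem_toFinset] at hb
    have hb2 := hb.2
    simp only [legs, Set.mem_union, not_or] at hb2
    simp [weight, hb2.1.1, hb2.1.2, hb2.2]
  rw [← e, ← finsum_mem_union' Set.disjoint_sdiff_left (hf.inter_of_left _)
    (aux_legs_support l m n), Set.diff_union_of_subset (aux_legs_subset h ha)]
  rfl

end Helpers

/-- **Statement 7.** For 2D partitions `(λ,μ,ν)`: for every `n` there are only
finitely many 3D partitions `η` asymptotic to `(λ,μ,ν)` with `#(η ∖ C_{λμν}) = n`;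
consequently for each integer `m` there are only finitely many such `η` with
renormalized volume `m`, so the topological vertex `V_{λμν}(p) = Σ_η p^{|η|}` is a
well-defined element of `ℤ((p))` (its coefficient function has partially
well-ordered support). -/
theorem finitely_many_partitions (l m n : Partition2D) :
    (∀ N : ℕ,
      {η : Set (ℕ × ℕ × ℕ) | IsPartition3D η ∧ IsAsymptotic l m n η ∧
        (η \ legs l m n).Finite ∧ (η \ legs l m n).ncard = N}.Finite) ∧
    (∀ v : ℤ,
      {η : Set (ℕ × ℕ × ℕ) | IsPartition3D η ∧ IsAsymptotic l m n η ∧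
        renormVolume l m n η = v}.Finite) ∧
    (Function.support (vertexCoeff l m n)).IsPWO := by
  refine ⟨aux_part1 l m n, fun v => ?_, ?_⟩
  · refine (aux_part1 l m n
      (v - ∑ᶠ b ∈ legs l m n, weight l m n b).toNat).subset ?_
    rintro η ⟨hp, ha, hv⟩
    have := aux_volume hp ha
    exact ⟨hp, ha, aux_diff_finite hp ha, by omega⟩
  · refine Set.IsWF.isPWO (BddBelow.isWF ⟨∑ᶠ b ∈ legs l m n, weight l m n b, ?_⟩)
    intro v hv
    have hv' : Nat.card {η : Set (ℕ × ℕ × ℕ) //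
        IsPartition3D η ∧ IsAsymptotic l m n η ∧ renormVolume l m n η = v} ≠ 0 := by
      intro h0
      apply hv
      simp only [vertexCoeff, h0, Nat.cast_zero]
    obtain ⟨⟨⟨η, hp, ha, hv⟩⟩, _⟩ := Nat.card_ne_zero.1 hv'
    have := aux_volume hp ha
    omega
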